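/- On J^∞(ℝ,ℝ²) with coordinates (x, y^k_1, y^k_2), k ∈ ℕ, define for each t ∈ ℝ the map Φ_t fixing x and sending y^k_L ↦ y^k_L + (t/2)(y^{k+2}_1 − y^{k+2}_2) for L = 1,2 and every k. Then: (a) Φ_0 = id and Φ_t ∘ Φ_s = Φ_{t+s} for all s, t ∈ ℝ; (b) the derivative at t = 0 of the components of Φ_t gives ξ = 0 and η^k_L = (y^{k+2}_1 − y^{k+2}_2)/2, and these components satisfy the Lie–Bäcklund recursion η^{k+1}_L = D η^k_L − y^{k+1}_L D ξ. Hence the Lie–Bäcklund field with these components is exponentiable with flow Φ_t. -/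

import Mathlib

open scoped BigOperators

/-- The infinite jet space `J^∞(ℝ, ℝ²)`: coordinates `x` and `y^k_L`
(`L ∈ Fin 2`, `k ∈ ℕ`). -/
abbrev JetB := ℝ × (Fin 2 × ℕ → ℝ)

/-- Partial derivative with respect to the coordinate `x`. -/
noncomputable def pdX (F : JetB → ℝ) : JetB → ℝ :=
  fun p => deriv (fun t => F (t, p.2)) p.1

/-- Partial derivative with respect to the coordinate `y^k_L`, `q = (L, k)`. -/
noncomputable def pdY (q : Fin 2 × ℕ) (F : JetB → ℝ) : JetB → ℝ :=
  fun p => deriv (fun t => F (p.1, Function.update p.2 q t)) (p.2 q)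

/-- A function on `J^∞(ℝ,ℝ²)` is admissible if it is a `C^∞` function of finitely
many of the coordinates. -/
def Admissible (F : JetB → ℝ) : Prop :=
  ∃ (S : Finset (Fin 2 × ℕ)) (g : ℝ × (↥S → ℝ) → ℝ),
    ContDiff ℝ (⊤ : ℕ∞) g ∧ ∀ p : JetB, F p = g (p.1, fun a => p.2 a.1)

/-- The total derivative `D = ∂/∂x + Σ_{L,k} y^{k+1}_L ∂/∂y^k_L`. -/
noncomputable def totD (F : JetB → ℝ) : JetB → ℝ :=
  fun p => pdX F p + ∑ᶠ q : Fin 2 × ℕ, p.2 (q.1, q.2 + 1) * pdY q F p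

/-- The components `η^k_L` of the Lie–Bäcklund field with principal components
`ξ, η^0_1, η^0_2`, determined by the recursion `η^{k+1}_L = D η^k_L − y^{k+1}_L D ξ`. -/
noncomputable def etaLB (ξ : JetB → ℝ) (η0 : Fin 2 → JetB → ℝ) (L : Fin 2) :
    ℕ → JetB → ℝ
  | 0 => η0 L
  | (k + 1) => fun p => totD (etaLB ξ η0 L k) p - p.2 (L, k + 1) * totD ξ p

/-- `F` depends only on the coordinates `(x, y^0_1, y^0_2, y^1_1, y^1_2)`. -/
def LowOrder (F : JetB → ℝ) : Prop :=
  ∀ p q : JetB, p.1 = q.1 →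
    (∀ (L : Fin 2) (k : ℕ), k ≤ 1 → p.2 (L, k) = q.2 (L, k)) → F p = F q

/-- `O_L = ∂η^0_L/∂x − y^1_L ∂ξ/∂x`. -/
noncomputable def Ocomp (ξ : JetB → ℝ) (η0 : Fin 2 → JetB → ℝ) (L : Fin 2) :
    JetB → ℝ :=
  fun p => pdX (η0 L) p - p.2 (L, 1) * pdX ξ p

/-- `N^Q_L = ∂η^0_L/∂y^0_Q − y^1_L ∂ξ/∂y^0_Q`. -/
noncomputable def Ncomp (ξ : JetB → ℝ) (η0 : Fin 2 → JetB → ℝ) (Q L : Fin 2) :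
    JetB → ℝ :=
  fun p => pdY (Q, 0) (η0 L) p - p.2 (L, 1) * pdY (Q, 0) ξ p

/-- `M^Q_L = ∂η^0_L/∂y^1_Q − y^1_L ∂ξ/∂y^1_Q`. -/
noncomputable def Mcomp (ξ : JetB → ℝ) (η0 : Fin 2 → JetB → ℝ) (Q L : Fin 2) :
    JetB → ℝ :=
  fun p => pdY (Q, 1) (η0 L) p - p.2 (L, 1) * pdY (Q, 1) ξ p

/-- `Q^R_M = ξ ∂M^R_M/∂x + Σ_K η^0_K ∂M^R_M/∂y^0_K
+ Σ_K (O_K + Σ_Q y^1_Q N^Q_K) ∂M^R_M/∂y^1_K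
− (Σ_N M^R_N ∂O_M/∂y^1_N + Σ_Q M^R_Q N^Q_M + Σ_{N,Q} M^R_N y^1_Q ∂N^Q_M/∂y^1_N)`. -/
noncomputable def Qcomp (ξ : JetB → ℝ) (η0 : Fin 2 → JetB → ℝ) (R M : Fin 2) :
    JetB → ℝ :=
  fun p =>
    ξ p * pdX (Mcomp ξ η0 R M) p
      + (∑ K, η0 K p * pdY (K, 0) (Mcomp ξ η0 R M) p)
      + (∑ K, (Ocomp ξ η0 K p + ∑ Q, p.2 (Q, 1) * Ncomp ξ η0 Q K p) *
          pdY (K, 1) (Mcomp ξ η0 R M) p)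
      - ((∑ N, Mcomp ξ η0 R N p * pdY (N, 1) (Ocomp ξ η0 M) p)
          + (∑ Q, Mcomp ξ η0 R Q p * Ncomp ξ η0 Q M p)
          + (∑ N, ∑ Q, Mcomp ξ η0 R N p * p.2 (Q, 1) * pdY (N, 1) (Ncomp ξ η0 Q M) p))

/-- A family `F t` of functions, each an admissible function of the coordinates, with
the finite set of relevant coordinates independent of `t` and `C^∞` joint dependence. -/
def AdmissibleT (F : ℝ → JetB → ℝ) : Prop :=
  ∃ (S : Finset (Fin 2 × ℕ)) (g : ℝ × ℝ × (↥S → ℝ) → ℝ),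
    ContDiff ℝ (⊤ : ℕ∞) g ∧ ∀ (t : ℝ) (p : JetB), F t p = g (t, p.1, fun a => p.2 a.1)

/-- `Φ` is a flow exponentiating the Lie–Bäcklund field with principal components
`ξ, η0` on `J^∞(ℝ,ℝ²)`. -/
def IsFlowOf (ξ : JetB → ℝ) (η0 : Fin 2 → JetB → ℝ) (Φ : ℝ → JetB → JetB) : Prop :=
  AdmissibleT (fun t p => (Φ t p).1) ∧
  (∀ q : Fin 2 × ℕ, AdmissibleT fun t p => (Φ t p).2 q) ∧
  Φ 0 = id ∧ (∀ s t : ℝ, Φ t ∘ Φ s = Φ (t + s)) ∧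
  (∀ p, deriv (fun t => (Φ t p).1) 0 = ξ p) ∧
  (∀ (L : Fin 2) (k : ℕ) (p : JetB),
    deriv (fun t => (Φ t p).2 (L, k)) 0 = etaLB ξ η0 L k p)

/-- The explicit map `Φ_t` fixing `x` and sending
`y^k_L ↦ y^k_L + (t/2)(y^{k+2}_1 − y^{k+2}_2)`. -/
noncomputable def Phex (t : ℝ) (p : JetB) : JetB :=
  (p.1, fun q => p.2 q + (t / 2) * (p.2 (0, q.2 + 2) - p.2 (1, q.2 + 2)))

theorem totD_zero (p : JetB) : totD (fun _ => (0 : ℝ)) p = 0 := by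
  simp [totD, pdX, pdY]

theorem hasDerivAt_update_apply (y : Fin 2 × ℕ → ℝ) (q a : Fin 2 × ℕ) (s : ℝ) :
    HasDerivAt (fun t => Function.update y q t a) (if q = a then 1 else 0) s := by
  by_cases h : q = a
  · subst h
    simpa using hasDerivAt_id' s
  · simpa [h, Function.update_of_ne (Ne.symm h)] using hasDerivAt_const s (y a)

theorem pdY_half_sub (q a b : Fin 2 × ℕ) (p : JetB) :
    pdY q (fun p' => (p'.2 a - p'.2 b) / 2) p
      = ((if q = a then 1 else 0) - (if q = b then 1 else 0)) / 2 :=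
  (((hasDerivAt_update_apply p.2 q a _).sub (hasDerivAt_update_apply p.2 q b _)).div_const
    2).deriv

/-- The total derivative raises the order of each coordinate in `(y_a - y_b) / 2` by one. -/
theorem totD_half_sub (a b : Fin 2 × ℕ) (hab : a ≠ b) (p : JetB) :
    totD (fun p' => (p'.2 a - p'.2 b) / 2) p
      = (p.2 (a.1, a.2 + 1) - p.2 (b.1, b.2 + 1)) / 2 := by
  have hX : pdX (fun p' => (p'.2 a - p'.2 b) / 2) p = 0 := by simp [pdX]
  simp only [totD, hX, pdY_half_sub, zero_add]
  rw [finsum_eq_sum_of_support_subset (s := {a, b}), Finset.sum_pair hab]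
  · simp only [if_true, if_neg hab, if_neg hab.symm]
    ring
  · intro q hq
    by_contra h
    simp only [Finset.coe_insert, Finset.coe_singleton, Set.mem_insert_iff,
      Set.mem_singleton_iff, not_or] at h
    simp [h.1, h.2] at hq

theorem etaLB_half_sub (L : Fin 2) (k : ℕ) :
    etaLB (fun _ => (0 : ℝ)) (fun _ p => (p.2 (0, 2) - p.2 (1, 2)) / 2) L k
      = fun p => (p.2 (0, k + 2) - p.2 (1, k + 2)) / 2 := by
  induction k with
  | zero => rfl
  | succ k ih =>
    funext p
    simp only [etaLB, ih, totD_zero, mul_zero, sub_zero]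
    rw [totD_half_sub _ _ (by simp)]

theorem Phex_zero : Phex 0 = id := by
  funext p
  simp [Phex]

theorem Phex_comp (s t : ℝ) : Phex t ∘ Phex s = Phex (t + s) := by
  funext p
  refine Prod.ext rfl (funext fun q => ?_)
  simp only [Phex, Function.comp_apply]
  ring

theorem deriv_Phex_snd (q : Fin 2 × ℕ) (p : JetB) :
    deriv (fun t => (Phex t p).2 q) 0 = (p.2 (0, q.2 + 2) - p.2 (1, q.2 + 2)) / 2 := by
  have h := ((((hasDerivAt_id (0 : ℝ)).div_const 2).mul_const
    (p.2 (0, q.2 + 2) - p.2 (1, q.2 + 2))).const_add (p.2 q)).deriv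
  exact h.trans (by ring)

theorem admissibleT_Phex_fst : AdmissibleT (fun t p => (Phex t p).1) :=
  ⟨∅, fun z => z.2.1, by fun_prop, fun _ _ => rfl⟩

theorem admissibleT_Phex_snd (q : Fin 2 × ℕ) : AdmissibleT (fun t p => (Phex t p).2 q) :=
  ⟨{q, (0, q.2 + 2), (1, q.2 + 2)},
    fun z => z.2.2 ⟨q, by simp⟩ +
      (z.1 / 2) * (z.2.2 ⟨(0, q.2 + 2), by simp⟩ - z.2.2 ⟨(1, q.2 + 2), by simp⟩),
    by fun_prop, fun _ _ => rfl⟩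

/-- the maps `Φ_t` form a one-parameter group; differentiating at
`t = 0` gives `ξ = 0` and `η^k_L = (y^{k+2}_1 − y^{k+2}_2)/2`, which satisfy the
Lie–Bäcklund recursion; hence the Lie–Bäcklund field with these components is
exponentiable with flow `Φ_t`. -/
theorem explicit_example :
    (Phex 0 = id) ∧
    (∀ s t : ℝ, Phex t ∘ Phex s = Phex (t + s)) ∧
    (∀ p : JetB, deriv (fun t => (Phex t p).1) 0 = 0) ∧
    (∀ (L : Fin 2) (k : ℕ) (p : JetB),
      deriv (fun t => (Phex t p).2 (L, k)) 0 = (p.2 (0, k + 2) - p.2 (1, k + 2)) / 2) ∧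
    (∀ (L : Fin 2) (k : ℕ) (p : JetB),
      (p.2 (0, k + 1 + 2) - p.2 (1, k + 1 + 2)) / 2 =
        totD (fun p' => (p'.2 (0, k + 2) - p'.2 (1, k + 2)) / 2) p -
          p.2 (L, k + 1) * totD (fun _ => (0 : ℝ)) p) ∧
    IsFlowOf (fun _ => (0 : ℝ))
      (fun _ p => (p.2 (0, 2) - p.2 (1, 2)) / 2) Phex := by
  refine ⟨Phex_zero, Phex_comp, fun p => by simp [Phex], fun L k p => deriv_Phex_snd (L, k) p,
    fun L k p => ?_, admissibleT_Phex_fst, admissibleT_Phex_snd, Phex_zero, Phex_comp,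
    fun p => by simp [Phex], fun L k p => ?_⟩
  · rw [totD_zero, totD_half_sub _ _ (by simp), mul_zero, sub_zero]
  · rw [etaLB_half_sub, deriv_Phex_snd]
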